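/- Let q > 3 be a Fermat prime. The number of triples (x, y, z) ∈ 𝔽_q^3 with x + y + z = 0 such that x, y and z are all primitive elements of 𝔽_q equals (q² − 6q + 5)/8. -/

import Mathlib

section QuadraticChar

variable {F : Type*} [Field F] [Fintype F] [DecidableEq F]

open Finset

/-- A finite field of odd characteristic has as many nonsquares as nonzero squares. -/
lemma two_mul_card_quadraticChar_eq_neg_one (hF : ringChar F ≠ 2) :
    2 * (#{x : F | quadraticChar F x = -1} : ℤ) = Fintype.card F - 1 := by
  have key (x : F) : 2 * (if quadraticChar F x = -1 then 1 else 0 : ℤ) =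
      1 - (if x = 0 then 1 else 0) - quadraticChar F x := by
    rcases eq_or_ne x 0 with rfl | h
    · simp
    · rcases quadraticChar_dichotomy h with h' | h' <;> simp [h, h']
  rw [card_filter]
  push_cast
  rw [mul_sum, sum_congr rfl fun x _ ↦ key x, sum_sub_distrib, quadraticChar_sum_zero hF]
  simp [sum_sub_distrib]

/-- If `-1` is a square, there are `(|F| - 5) / 4` ways of writing `1` as an ordered sum of two
nonzero squares. -/
lemma four_mul_card_quadraticChar_eq_one_and (hF : ringChar F ≠ 2)
    (hneg : quadraticChar F (-1) = 1) :
    4 * (#{v : F | quadraticChar F v = 1 ∧ quadraticChar F (1 - v) = 1} : ℤ) =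
      Fintype.card F - 5 := by
  have key (v : F) :
      4 * (if quadraticChar F v = 1 ∧ quadraticChar F (1 - v) = 1 then 1 else 0 : ℤ) =
      1 - 2 * (if v = 0 then 1 else 0) - 2 * (if v = 1 then 1 else 0) + quadraticChar F v
        + quadraticChar F (1 - v) + quadraticChar F v * quadraticChar F (1 - v) := by
    rcases eq_or_ne v 0 with rfl | h
    · simp
    rcases eq_or_ne v 1 with rfl | h1
    · simp
    have h2 : 1 - v ≠ 0 := sub_ne_zero.mpr h1.symm
    rcases quadraticChar_dichotomy h with h' | h' <;>
      rcases quadraticChar_dichotomy h2 with h'' | h'' <;> simp [h, h1, h', h'']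
  have hJ : ∑ v : F, quadraticChar F v * quadraticChar F (1 - v) = -1 := by
    have h := jacobiSum_nontrivial_inv (quadraticChar_ne_one hF)
    rwa [(quadraticChar_isQuadratic F).inv, hneg] at h
  have hS : ∑ v : F, quadraticChar F (1 - v) = 0 := by
    rw [← quadraticChar_sum_zero hF]
    exact (Equiv.subLeft (1 : F)).sum_comp (quadraticChar F)
  rw [card_filter]
  push_cast
  rw [mul_sum, sum_congr rfl fun v _ ↦ key v]
  simp only [sum_add_distrib, sum_sub_distrib, ← mul_sum, hJ, hS, quadraticChar_sum_zero hF]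
  simp
  ring

/-- If `-1` is a square, a triple of nonsquares with sum zero is determined by its first entry `x`
and the nonzero square `v` for which the triple is `(x, -v * x, -(1 - v) * x)`. -/
def nonsquareTripleEquiv (hneg : quadraticChar F (-1) = 1) :
    {t : F × F × F // t.1 + t.2.1 + t.2.2 = 0 ∧ quadraticChar F t.1 = -1 ∧
      quadraticChar F t.2.1 = -1 ∧ quadraticChar F t.2.2 = -1} ≃
    {x : F // quadraticChar F x = -1} ×
      {v : F // quadraticChar F v = 1 ∧ quadraticChar F (1 - v) = 1} where
  toFun t := ⟨⟨t.1.1, t.2.2.1⟩, ⟨-1 * (t.1.2.1 * t.1.1⁻¹), by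
    obtain ⟨⟨x, y, z⟩, h, hx, hy, hz⟩ := t
    dsimp only at h hx hy hz ⊢
    have hx0 : x ≠ 0 := by rintro rfl; simp at hx
    have hxi : quadraticChar F x⁻¹ = -1 := by
      have h1 : quadraticChar F (x * x⁻¹) = 1 := by rw [mul_inv_cancel₀ hx0, map_one]
      rw [map_mul, hx] at h1
      linarith
    have hv : 1 - -1 * (y * x⁻¹) = -1 * (z * x⁻¹) := by
      field_simp
      linear_combination h
    rw [hv]
    simp only [map_mul, hneg, hxi, hy, hz]
    simp⟩⟩
  invFun p := ⟨(p.1.1, -1 * (p.2.1 * p.1.1), -1 * ((1 - p.2.1) * p.1.1)), by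
    obtain ⟨⟨x, hx⟩, v, hv, hv'⟩ := p
    refine ⟨by ring, hx, ?_, ?_⟩ <;> simp only [map_mul, hneg, hx, hv, hv'] <;> simp⟩
  left_inv := by
    rintro ⟨⟨x, y, z⟩, h, hx, hy, hz⟩
    dsimp only at h hx
    have hx0 : x ≠ 0 := by rintro rfl; simp at hx
    simp only [Subtype.mk.injEq, Prod.mk.injEq, true_and]
    constructor
    · field_simp
    · field_simp
      linear_combination -h
  right_inv := by
    rintro ⟨⟨x, hx⟩, v, hv, hv'⟩
    have hx0 : x ≠ 0 := by rintro rfl; simp at hx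
    simp only [Prod.mk.injEq, Subtype.mk.injEq, true_and]
    field_simp

/-- If `|F| - 1` is a power of two, the primitive elements of `F` are its nonsquares. -/
lemma orderOf_eq_card_sub_one_iff_quadraticChar {n : ℕ} (hn : Fintype.card F = 2 ^ (n + 1) + 1)
    (hF : ringChar F ≠ 2) (x : F) :
    orderOf x = Fintype.card F - 1 ↔ quadraticChar F x = -1 := by
  have hhalf : Fintype.card F / 2 = 2 ^ n := by rw [hn, pow_succ]; omega
  have hpos : 0 < 2 ^ n := by positivity
  constructor
  · intro h
    have hx0 : x ≠ 0 := by
      rintro rfl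
      rw [orderOf_zero, hn, pow_succ] at h
      omega
    refine (quadraticChar_dichotomy hx0).resolve_left fun h1 ↦ ?_
    have h2 := quadraticChar_eq_pow_of_char_ne_two' hF x
    rw [h1, hhalf] at h2
    refine pow_ne_one_of_lt_orderOf hpos.ne' ?_ (x := x) (by simpa using h2.symm)
    rw [h, hn, pow_succ]
    omega
  · intro h
    have hx0 : x ≠ 0 := by rintro rfl; simp at h
    have h2 := quadraticChar_eq_pow_of_char_ne_two' hF x
    rw [h, hhalf] at h2
    rw [hn, Nat.add_sub_cancel]
    apply orderOf_eq_prime_pow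
    · rw [← h2]
      simpa using Ring.neg_one_ne_one_of_char_ne_two hF
    · simpa [hn] using FiniteField.pow_card_sub_one_eq_one x hx0

end QuadraticChar

theorem stmt_4 (q : ℕ) (hprime : Nat.Prime q) (hfermat : ∃ l : ℕ, q = 2 ^ (2 ^ l) + 1)
    (hq3 : 3 < q) (F : Type*) [Field F] [Fintype F] (hcard : Fintype.card F = q) :
    (Nat.card {t : F × F × F // t.1 + t.2.1 + t.2.2 = 0 ∧
        orderOf t.1 = q - 1 ∧ orderOf t.2.1 = q - 1 ∧ orderOf t.2.2 = q - 1} : ℝ) =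
      ((q : ℝ) ^ 2 - 6 * q + 5) / 8 := by
  classical
  obtain ⟨l, hl⟩ := hfermat
  obtain ⟨n, hn⟩ : ∃ n, 2 ^ l = n + 2 := by
    refine Nat.exists_eq_add_of_le' ?_
    by_contra! h
    interval_cases h2 : 2 ^ l <;> omega
  rw [hn] at hl
  have h4 : q % 4 = 1 := by rw [hl, pow_add]; omega
  have hF : ringChar F ≠ 2 := fun h ↦ by
    have := FiniteField.even_card_iff_char_two.mp h
    omega
  have hneg : quadraticChar F (-1) = 1 := by
    rw [quadraticChar_neg_one hF, hcard, ZMod.χ₄_nat_one_mod_four h4]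
  subst hcard
  simp only [orderOf_eq_card_sub_one_iff_quadraticChar (n := n + 1) hl hF]
  rw [Nat.card_congr (nonsquareTripleEquiv hneg), Nat.card_prod, Nat.card_eq_fintype_card,
    Nat.card_eq_fintype_card, Fintype.card_subtype, Fintype.card_subtype]
  have hA := congrArg (Int.cast : ℤ → ℝ) (two_mul_card_quadraticChar_eq_neg_one hF)
  have hB := congrArg (Int.cast : ℤ → ℝ) (four_mul_card_quadraticChar_eq_one_and hF hneg)
  push_cast at hA hB ⊢
  rw [eq_div_iff (by norm_num)]
  generalize Finset.card (α := F) {v | quadraticChar F v = 1 ∧ quadraticChar F (1 - v) = 1} = B at *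
  linear_combination 4 * (B : ℝ) * hA + (Fintype.card F - 1 : ℝ) * hB
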